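/- Let h_n denote the number of condensible permutations of length n. Then h_n/n! → 0 as n → ∞; that is, almost all permutations of length n are non-condensible. -/

import Mathlib

/-- The pattern `q` is condensible with parameter `s`: `1 ≤ s ≤ k-1`, the
rightmost `s` entries of `q` are its `s` largest entries, the leftmost `s`
entries are its `s` smallest entries, and the leftmost `s` entries are
order-isomorphic to the rightmost `s` entries. (0-indexed.) -/
def CondensibleAt {k : ℕ} (q : Equiv.Perm (Fin k)) (s : ℕ) : Prop :=
  ∃ _hs1 : 1 ≤ s, ∃ _hs2 : s ≤ k - 1,
    (∀ j : Fin k, k - s ≤ (j : ℕ) → k - s ≤ (q j : ℕ)) ∧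
    (∀ j : Fin k, (j : ℕ) < s → (q j : ℕ) < s) ∧
    ∀ j r : Fin k, ∀ _hj : (j : ℕ) < s, ∀ _hr : (r : ℕ) < s,
      (q j < q r ↔
        q ⟨(j : ℕ) + (k - s), by omega⟩ < q ⟨(r : ℕ) + (k - s), by omega⟩)

/-- The pattern `q` is condensible. -/
def Condensible {k : ℕ} (q : Equiv.Perm (Fin k)) : Prop :=
  ∃ s : ℕ, CondensibleAt q s

open Finset in
/-- A bound on the number of permutations of a finite type that map the set cut out by `p` into
itself. -/
theorem card_perm_mapsTo_le {α : Type*} [Fintype α] [DecidableEq α] (p : α → Prop)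
    [DecidablePred p] :
    #{q : Equiv.Perm α | ∀ x, p x → p (q x)} ≤
      (Fintype.card {x // p x}).factorial * (Fintype.card {x // ¬ p x}).factorial := by
  have iff_of (q : {q : Equiv.Perm α // ∀ x, p x → p (q x)}) (x : α) : p (q.1 x) ↔ p x := by
    refine ⟨fun h => ?_, q.2 x⟩
    simpa using Equiv.Perm.perm_symm_on_of_perm_on_finite (fun x hx => q.2 x hx) h
  rw [← Fintype.card_subtype, ← Fintype.card_perm, ← Fintype.card_perm, ← Fintype.card_prod]
  refine Fintype.card_le_of_injective
    (fun q => (q.1.subtypePerm (iff_of q), q.1.subtypePerm fun x => not_congr (iff_of q x))) ?_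
  intro q r h
  ext x
  rw [Prod.mk.injEq] at h
  by_cases hx : p x
  · simpa using congrArg Subtype.val (Equiv.congr_fun h.1 ⟨x, hx⟩)
  · simpa using congrArg Subtype.val (Equiv.congr_fun h.2 ⟨x, hx⟩)

theorem factorial_add_two_mul_factorial_add_two_le (a b : ℕ) :
    (a + 2).factorial * (b + 2).factorial ≤ 2 * (a + b + 2).factorial := by
  induction a with
  | zero => simp
  | succ a ih =>
    calc (a + 3).factorial * (b + 2).factorial
        = (a + 3) * ((a + 2).factorial * (b + 2).factorial) := by
          rw [Nat.factorial_succ (a + 2), mul_assoc]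
      _ ≤ (a + b + 3) * (2 * (a + b + 2).factorial) := Nat.mul_le_mul (by omega) ih
      _ = 2 * (a + 1 + b + 2).factorial := by
          rw [show a + 1 + b + 2 = (a + b + 2) + 1 by ring, Nat.factorial_succ (a + b + 2)]
          ring

theorem sum_factorial_mul_factorial_le (m : ℕ) :
    ∑ i ∈ Finset.range (m + 2), (i + 1).factorial * (m + 2 - i).factorial ≤
      4 * (m + 2).factorial := by
  rw [Finset.sum_range_succ, Finset.sum_range_succ']
  have middle : ∑ i ∈ Finset.range m, (i + 1 + 1).factorial * (m + 2 - (i + 1)).factorial ≤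
      m * (2 * (m + 1).factorial) := by
    refine (Finset.sum_le_card_nsmul _ _ (2 * (m + 1).factorial) fun i hi => ?_).trans
      (by simp)
    have hi := Finset.mem_range.mp hi
    obtain ⟨b, rfl⟩ := Nat.exists_eq_add_of_lt hi
    have := factorial_add_two_mul_factorial_add_two_le i b
    rwa [show i + b + 1 + 2 - (i + 1) = b + 2 by omega]
  have last : m + 2 - (m + 1) = 1 := by omega
  have succ := Nat.factorial_succ (m + 1)
  simp only [last, Nat.factorial_one, mul_one, zero_add, one_mul, Nat.sub_zero]
  nlinarith [Nat.factorial_pos (m + 1)]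

open Finset in
theorem card_condensible_le (m : ℕ) :
    Nat.card {q : Equiv.Perm (Fin (m + 3)) // Condensible q} ≤ 4 * (m + 2).factorial := by
  classical
  refine le_trans ?_ (sum_factorial_mul_factorial_le m)
  have sub : ({q : Equiv.Perm (Fin (m + 3)) | Condensible q} : Finset _) ⊆
      (range (m + 2)).biUnion fun i =>
        {q : Equiv.Perm (Fin (m + 3)) | ∀ x : Fin (m + 3), (x : ℕ) < i + 1 → (q x : ℕ) < i + 1} := by
    intro q hq
    obtain ⟨s, hs₁, hs₂, -, h, -⟩ := (mem_filter.mp hq).2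
    simp only [mem_biUnion, mem_range, mem_filter, mem_univ, true_and]
    refine ⟨s - 1, by omega, ?_⟩
    rwa [Nat.sub_add_cancel hs₁]
  rw [Nat.card_eq_fintype_card, Fintype.card_subtype]
  refine (card_le_card sub).trans (card_biUnion_le.trans (sum_le_sum fun i hi => ?_))
  have hi := mem_range.mp hi
  have card_prefix : Fintype.card {x : Fin (m + 3) // (x : ℕ) < i + 1} = i + 1 := by
    rw [Fintype.card_subtype, Fin.card_filter_val_lt]
    omega
  have card_le := card_perm_mapsTo_le fun x : Fin (m + 3) => (x : ℕ) < i + 1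
  rw [Fintype.card_subtype_compl, card_prefix, Fintype.card_fin,
    show m + 3 - (i + 1) = m + 2 - i by omega] at card_le
  exact le_trans (le_of_eq (by congr!)) card_le

/-- Let `h_n` be the number of condensible permutations of length `n` (i.e.
permutations with first entry smaller than last entry satisfying the
condensibility conditions). Then `h_n/n! → 0` as `n → ∞`: almost all
permutations are non-condensible. -/
theorem stmt_17 :
    Filter.Tendsto
      (fun n : ℕ =>
        (Nat.card {q : Equiv.Perm (Fin n) //
            (∃ h : 0 < n, q ⟨0, h⟩ < q ⟨n - 1, by omega⟩) ∧ Condensible q} : ℝ)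
          / Nat.factorial n)
      Filter.atTop (nhds 0) := by
  refine squeeze_zero' (.of_forall fun n => by positivity) ?_
    (tendsto_const_div_atTop_nhds_zero_nat 4)
  filter_upwards [Filter.eventually_ge_atTop 3] with n hn
  obtain ⟨m, rfl⟩ := Nat.exists_eq_add_of_le' hn
  have card_le : Nat.card {q : Equiv.Perm (Fin (m + 3)) //
      (∃ h : 0 < m + 3, q ⟨0, h⟩ < q ⟨m + 3 - 1, by omega⟩) ∧ Condensible q} ≤
        4 * (m + 2).factorial :=
    (Nat.card_le_card_of_injective _
      (Subtype.map_injective (fun _ h => h.2) Function.injective_id)).trans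
      (card_condensible_le m)
  rw [div_le_div_iff₀ (by positivity) (by positivity), Nat.factorial_succ (m + 2)]
  have card_le' := mul_le_mul_of_nonneg_right (Nat.cast_le (α := ℝ).mpr card_le)
    (Nat.cast_nonneg (m + 3))
  refine card_le'.trans_eq ?_
  push_cast
  ring
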